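/- For every integer n ≥ 2, the integral I_n := ∫_{(0,∞)^n} du · |u|₁ e^{−|u|₁} / ∏_{j=1}^n (u_j + u_{j+1}) (with the cyclic convention u_{n+1} := u_1) is finite and equals I_n = (2π)^{n−2} · Γ(n/2)² / Γ(n). In particular, for every positive integer n, I_{2n} = (2π)^{2n−2} · ((n−1)!)² / (2n−1)!. -/

import Mathlib

open MeasureTheory

/-- The integrand of `I_n`: for `u ∈ (0,∞)ⁿ`, `|u|₁ e^{−|u|₁} / ∏_{j=1}^n (u_j + u_{j+1})`,
with the cyclic convention `u_{n+1} := u_1` (realized by addition in `Fin n`). -/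
noncomputable def cyclicIntegrand (n : ℕ) [NeZero n] (u : Fin n → ℝ) : ℝ :=
  (∑ j, u j) * Real.exp (-∑ j, u j) / ∏ j, (u j + u (j + 1))


lemma aux_int (r c : ℝ) (hr : 0 < r) (hc : 0 < c) :
    IntegrableOn (fun v : ℝ => v ^ (r - 1) * Real.exp (-(c * v))) (Set.Ioi 0) := by
  have := integrableOn_rpow_mul_exp_neg_mul_rpow (p := 1) (s := r - 1) (b := c) (by linarith) one_pos hc
  simpa using this

noncomputable def bker (s : ℂ) (m a : ℝ) (t v : ℝ) : ℂ :=
  (t : ℂ) ^ ((m : ℂ) - 1) * (v : ℂ) ^ (s - 1) * Complex.exp (-(((a + v : ℝ) : ℂ) * t))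

lemma bker_norm (s : ℂ) (m a t v : ℝ) (ht : 0 < t) (hv : 0 < v) :
    ‖bker s m a t v‖ = (t ^ (m - 1) * Real.exp (-(a * t))) * (v ^ (s.re - 1) * Real.exp (-(t * v))) := by
  unfold bker
  rw [norm_mul, norm_mul, Complex.norm_cpow_eq_rpow_re_of_pos ht, Complex.norm_cpow_eq_rpow_re_of_pos hv,
    Complex.norm_exp]
  have : (-(((a + v : ℝ) : ℂ) * t)).re = -(a * t) + -(t * v) := by
    rw [← Complex.ofReal_mul, ← Complex.ofReal_neg, Complex.ofReal_re]; ring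
  rw [this, Real.exp_add]
  simp
  ring

lemma bker_integrable (s : ℂ) (m a : ℝ) (hs : 0 < s.re) (hm : s.re < m) (ha : 0 < a) :
    Integrable (Function.uncurry (bker s m a))
      ((volume.restrict (Set.Ioi 0)).prod (volume.restrict (Set.Ioi 0))) := by
  have hmeas : Measurable (Function.uncurry (bker s m a)) := by
    unfold bker Function.uncurry
    fun_prop
  rw [integrable_prod_iff hmeas.aestronglyMeasurable]
  have hn : ∀ t : ℝ, 0 < t → (fun v => (t ^ (m - 1) * Real.exp (-(a * t))) * (v ^ (s.re - 1) * Real.exp (-(t * v))))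
      =ᵐ[volume.restrict (Set.Ioi 0)] fun v => ‖bker s m a t v‖ := by
    intro t ht
    filter_upwards [ae_restrict_mem measurableSet_Ioi] with v hv
    exact (bker_norm s m a t v ht hv).symm
  refine ⟨?_, ?_⟩
  · filter_upwards [ae_restrict_mem measurableSet_Ioi] with t ht
    have h1 : Measurable (fun v => bker s m a t v) := by unfold bker; fun_prop
    have h2 := ((aux_int s.re t hs ht).const_mul (t ^ (m - 1) * Real.exp (-(a * t)))).congr (hn t ht)
    exact (integrable_norm_iff h1.aestronglyMeasurable).1 h2
  · have : IntegrableOn (fun t : ℝ => Real.Gamma s.re * (t ^ ((m - s.re) - 1) * Real.exp (-(a * t)))) (Set.Ioi 0) :=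
      (aux_int (m - s.re) a (by linarith) ha).const_mul _
    refine this.congr ?_
    filter_upwards [ae_restrict_mem measurableSet_Ioi] with t ht
    have := integral_congr_ae (hn t ht)
    simp only [Function.uncurry]
    rw [← this, integral_const_mul, Real.integral_rpow_mul_exp_neg_mul_Ioi hs ht]
    have ht' : (0:ℝ) < t := ht
    rw [one_div, Real.inv_rpow ht'.le, ← Real.rpow_neg ht'.le,
      show m - s.re - 1 = (m - 1) + (-s.re) by ring, Real.rpow_add ht']
    ring

lemma beta_ioi (s : ℂ) (m a : ℝ) (hs : 0 < s.re) (hm : s.re < m) (ha : 0 < a) :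
    IntegrableOn (fun v : ℝ => (v : ℂ) ^ (s - 1) * (1 / ((a + v : ℝ) : ℂ)) ^ (m : ℂ)) (Set.Ioi 0) ∧
    (∫ v in Set.Ioi (0:ℝ), (v : ℂ) ^ (s - 1) * (1 / ((a + v : ℝ) : ℂ)) ^ (m : ℂ)) =
      (1 / (a : ℂ)) ^ ((m : ℂ) - s) * Complex.Gamma s * Complex.Gamma (m - s) / Complex.Gamma m := by
  have hm0 : 0 < (m : ℂ).re := by simp; linarith
  have hG : Complex.Gamma m ≠ 0 := Complex.Gamma_ne_zero_of_re_pos hm0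
  have hI := bker_integrable s m a hs hm ha
  have h1 : (fun v => ∫ t in Set.Ioi (0:ℝ), bker s m a t v) =ᵐ[volume.restrict (Set.Ioi 0)]
      fun v : ℝ => (v : ℂ) ^ (s - 1) * (1 / ((a + v : ℝ) : ℂ)) ^ (m : ℂ) * Complex.Gamma m := by
    filter_upwards [ae_restrict_mem measurableSet_Ioi] with v hv
    have hv' : (0:ℝ) < v := hv
    have := Complex.integral_cpow_mul_exp_neg_mul_Ioi hm0 (show 0 < a + v by linarith)
    rw [mul_assoc, ← this, ← integral_const_mul]
    congr 1; ext t; unfold bker; ring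
  have h2 : (fun t => ∫ v in Set.Ioi (0:ℝ), bker s m a t v) =ᵐ[volume.restrict (Set.Ioi 0)]
      fun t : ℝ => Complex.Gamma s * ((t : ℂ) ^ ((m - s) - 1) * Complex.exp (-((a : ℂ) * t))) := by
    filter_upwards [ae_restrict_mem measurableSet_Ioi] with t ht
    have ht' : (0:ℝ) < t := ht
    have htc : (t : ℂ) ≠ 0 := by exact_mod_cast ht'.ne'
    have := Complex.integral_cpow_mul_exp_neg_mul_Ioi hs ht'
    have e : ∀ v : ℝ, bker s m a t v = (t : ℂ) ^ ((m : ℂ) - 1) * Complex.exp (-((a : ℂ) * t)) *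
        ((v : ℂ) ^ (s - 1) * Complex.exp (-((t : ℂ) * v))) := by
      intro v; unfold bker
      rw [show (-(((a + v : ℝ) : ℂ) * t)) = -((a : ℂ) * t) + -((t : ℂ) * v) by push_cast; ring, Complex.exp_add]
      ring
    simp_rw [e]
    rw [integral_const_mul, this, one_div, Complex.inv_cpow, ← Complex.cpow_neg,
      show (m : ℂ) - s - 1 = (m - 1) + (-s) by ring, Complex.cpow_add _ _ htc]
    · ring
    · rw [Complex.arg_ofReal_of_nonneg ht'.le]; exact Real.pi_pos.ne
  constructor
  · have := hI.swap.integral_prod_left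
    have := (this.congr h1).mul_const (Complex.Gamma m)⁻¹
    refine this.congr (Filter.Eventually.of_forall fun v => ?_)
    simp only; rw [mul_assoc, mul_inv_cancel₀ hG, mul_one]
  · have := integral_integral_swap hI
    rw [integral_congr_ae h1, integral_congr_ae h2, integral_const_mul, integral_mul_const,
      Complex.integral_cpow_mul_exp_neg_mul_Ioi (by simpa using hm) ha] at this
    rw [eq_div_iff hG, ← this]; ring

lemma exp_cpow_aux (y : ℝ) (w : ℂ) : ((Real.exp y : ℝ) : ℂ) ^ w = Complex.exp (y * w) := by
  rw [Complex.cpow_def_of_ne_zero (by exact_mod_cast (Real.exp_pos y).ne'), ← Complex.ofReal_log (Real.exp_pos y).le,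
    Real.log_exp]

lemma image_exp_aux : (fun x : ℝ => Real.exp (2 * Real.pi * x)) '' Set.univ = Set.Ioi 0 := by
  ext v
  simp only [Set.image_univ, Set.mem_range, Set.mem_Ioi]
  constructor
  · rintro ⟨x, rfl⟩; exact Real.exp_pos _
  · intro hv
    refine ⟨Real.log v / (2 * Real.pi), ?_⟩
    rw [mul_div_cancel₀ _ (by positivity), Real.exp_log hv]

lemma change_exp (h : ℝ → ℂ) :
    (IntegrableOn h (Set.Ioi 0) → Integrable (fun x : ℝ =>
      ((2 * Real.pi * Real.exp (2 * Real.pi * x) : ℝ) : ℂ) * h (Real.exp (2 * Real.pi * x)))) ∧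
    ∫ v in Set.Ioi (0:ℝ), h v = ∫ x : ℝ,
      ((2 * Real.pi * Real.exp (2 * Real.pi * x) : ℝ) : ℂ) * h (Real.exp (2 * Real.pi * x)) := by
  have hd : ∀ x ∈ (Set.univ : Set ℝ), HasDerivWithinAt (fun x : ℝ => Real.exp (2 * Real.pi * x))
      (2 * Real.pi * Real.exp (2 * Real.pi * x)) Set.univ x := by
    intro x _
    have := ((hasDerivAt_id x).const_mul (2 * Real.pi)).exp
    simp only [id, mul_one] at this
    rw [mul_comm (2 * Real.pi) (Real.exp _)]
    exact this.hasDerivWithinAt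
  have hinj : Set.InjOn (fun x : ℝ => Real.exp (2 * Real.pi * x)) Set.univ := by
    intro x _ y _ hxy
    have := Real.exp_injective hxy
    exact mul_left_cancel₀ (by positivity) this
  have habs : ∀ x : ℝ, |2 * Real.pi * Real.exp (2 * Real.pi * x)| = 2 * Real.pi * Real.exp (2 * Real.pi * x) :=
    fun x => abs_of_pos (by positivity)
  have h1 := integral_image_eq_integral_abs_deriv_smul MeasurableSet.univ hd hinj h
  have h2 := integrableOn_image_iff_integrableOn_abs_deriv_smul MeasurableSet.univ hd hinj h
  rw [image_exp_aux] at h1 h2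
  simp only [habs, Complex.real_smul, integrableOn_univ, Measure.restrict_univ] at h1 h2
  exact ⟨h2.1, h1⟩

noncomputable def gfun (N : ℕ) (x : ℝ) : ℝ := (Real.pi / Real.cosh (Real.pi * x)) ^ N / (2 * Real.pi)

lemma gfun_nonneg (N : ℕ) (x : ℝ) : 0 ≤ gfun N x := by
  unfold gfun; have := Real.cosh_pos (Real.pi * x); positivity

lemma gfun_succ (N : ℕ) (x : ℝ) : gfun (N + 1) x = (Real.pi / Real.cosh (Real.pi * x)) * gfun N x := by
  unfold gfun; rw [pow_succ]; ring

lemma one_add_exp_aux (x : ℝ) :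
    1 + Real.exp (2 * Real.pi * x) = 2 * Real.cosh (Real.pi * x) * Real.exp (Real.pi * x) := by
  rw [Real.cosh_eq, show 2 * Real.pi * x = Real.pi * x + Real.pi * x by ring, Real.exp_add, Real.exp_neg]
  have := (Real.exp_pos (Real.pi * x)).ne'
  field_simp
  ring

lemma gfun_integral (n : ℕ) (hn : 1 ≤ n) :
    Integrable (gfun n) ∧ ∫ x, gfun n x =
      (2 * Real.pi) ^ n / (2 * Real.pi) ^ 2 * (Real.Gamma ((n : ℝ) / 2) ^ 2 / Real.Gamma (n : ℝ)) := by
  have hn' : (1:ℝ) ≤ n := by exact_mod_cast hn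
  obtain ⟨h1, h2⟩ := beta_ioi (((n : ℝ) / 2 : ℝ) : ℂ) n 1 (by simp; linarith) (by simp; linarith) one_pos
  obtain ⟨h3, h4⟩ := change_exp (fun v : ℝ => (v : ℂ) ^ ((((n : ℝ) / 2 : ℝ) : ℂ) - 1) *
    (1 / ((1 + v : ℝ) : ℂ)) ^ (((n : ℝ)) : ℂ))
  have key : ∀ x : ℝ, ((2 * Real.pi * Real.exp (2 * Real.pi * x) : ℝ) : ℂ) *
      (((Real.exp (2 * Real.pi * x) : ℝ) : ℂ) ^ ((((n : ℝ) / 2 : ℝ) : ℂ) - 1) *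
    (1 / ((1 + Real.exp (2 * Real.pi * x) : ℝ) : ℂ)) ^ (((n : ℝ)) : ℂ)) =
      (((2 * Real.pi) ^ 2 / (2 * Real.pi) ^ n * gfun n x : ℝ) : ℂ) := by
    intro x
    have hc := (Real.cosh_pos (Real.pi * x)).ne'
    have he := (Real.exp_pos (Real.pi * x)).ne'
    have hp := Real.pi_pos.ne'
    rw [show (((n : ℝ)) : ℂ) = (n : ℂ) by simp, Complex.cpow_natCast, exp_cpow_aux,
      show (((2 * Real.pi * x : ℝ) : ℂ) * ((((n : ℝ) / 2 : ℝ) : ℂ) - 1)) =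
        ((n * (Real.pi * x) - 2 * Real.pi * x : ℝ) : ℂ) by push_cast; ring, ← Complex.ofReal_exp]
    norm_cast
    rw [Real.exp_sub, Real.exp_nat_mul, one_add_exp_aux]
    unfold gfun
    have he2 := (Real.exp_pos (2 * Real.pi * x)).ne'
    simp only [div_pow, mul_pow, one_pow]
    field_simp
  simp_rw [key] at h3 h4
  have hI : Integrable (gfun n) := by
    have h5 := (h3 h1).re.const_mul ((2 * Real.pi) ^ n / (2 * Real.pi) ^ 2)
    refine h5.congr (Filter.Eventually.of_forall fun x => ?_)
    have hp := Real.pi_pos.ne'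
    simp only [RCLike.re_to_complex, Complex.ofReal_re]
    field_simp
  refine ⟨hI, ?_⟩
  have hn2 : ((n:ℝ):ℂ) - (((n : ℝ) / 2 : ℝ) : ℂ) = (((n : ℝ) / 2 : ℝ) : ℂ) := by push_cast; ring
  rw [h4, hn2, integral_complex_ofReal, Complex.Gamma_ofReal, Complex.Gamma_ofReal] at h2
  simp only [Complex.ofReal_one, div_one, Complex.one_cpow, one_mul] at h2
  rw [integral_const_mul] at h2
  norm_cast at h2
  have hp := Real.pi_pos.ne'
  rw [sq (Real.Gamma _), ← h2]
  field_simp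

lemma mellinA (a : ℝ) (ha : 0 < a) (x : ℝ) :
    IntegrableOn (fun v : ℝ => (v : ℂ) ^ (-1/2 + Complex.I * x) * (1 / ((a + v : ℝ) : ℂ))) (Set.Ioi 0) ∧
    (∫ v in Set.Ioi (0:ℝ), (v : ℂ) ^ (-1/2 + Complex.I * x) * (1 / ((a + v : ℝ) : ℂ))) =
      (a : ℂ) ^ (-1/2 + Complex.I * x) * ((Real.pi / Real.cosh (Real.pi * x) : ℝ) : ℂ) := by
  have h := beta_ioi (1/2 + Complex.I * x) 1 a (by simp) (by simp; norm_num) ha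
  rw [show (1/2 + Complex.I * x : ℂ) - 1 = -1/2 + Complex.I * x by ring] at h
  simp only [Complex.ofReal_one, Complex.cpow_one, Complex.Gamma_one, div_one] at h
  refine ⟨h.1, ?_⟩
  rw [h.2, mul_assoc, Complex.Gamma_mul_Gamma_one_sub, one_div, Complex.inv_cpow, ← Complex.cpow_neg]
  · congr 1
    · congr 1; ring
    · push_cast
      rw [show (Real.pi : ℂ) * (1/2 + Complex.I * x) = (Real.pi * x) * Complex.I + Real.pi / 2 by ring,
        Complex.sin_add_pi_div_two, Complex.cos_mul_I]
  · rw [Complex.arg_ofReal_of_nonneg ha.le]; exact Real.pi_pos.ne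

lemma mellinB (a : ℝ) (ha : 0 < a) :
    ((1 / (a + 1) : ℝ) : ℂ) = ∫ x : ℝ, (a : ℂ) ^ (-1/2 + Complex.I * x) * (gfun 1 x : ℂ) := by
  set η : ℝ := Real.log a / (2 * Real.pi) with hη
  have hla : Real.pi * η = Real.log a / 2 := by rw [hη]; have := Real.pi_pos.ne'; field_simp
  have h := (mellinA 1 one_pos η).2
  rw [(change_exp _).2] at h
  have key : ∀ x : ℝ, ((2 * Real.pi * Real.exp (2 * Real.pi * x) : ℝ) : ℂ) *
      (((Real.exp (2 * Real.pi * x) : ℝ) : ℂ) ^ (-1/2 + Complex.I * η) *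
        (1 / ((1 + Real.exp (2 * Real.pi * x) : ℝ) : ℂ))) =
      (2 * Real.pi * (a : ℂ) ^ (1/2 : ℂ)) * ((a : ℂ) ^ (-1/2 + Complex.I * x) * (gfun 1 x : ℂ)) := by
    intro x
    have hc := (Real.cosh_pos (Real.pi * x)).ne'
    have he := (Real.exp_pos (Real.pi * x)).ne'
    have hp := Real.pi_pos.ne'
    have e1 : (a : ℂ) ^ (1/2 : ℂ) * (a : ℂ) ^ (-1/2 + Complex.I * x) =
        Complex.exp (2 * Real.pi * x * Complex.I * η) := by
      rw [← Complex.cpow_add _ _ (by exact_mod_cast ha.ne'), ← Real.exp_log ha, exp_cpow_aux]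
      congr 1
      rw [show Real.log a = 2 * (Real.pi * η) by rw [hla]; ring]
      push_cast; ring
    have e2 : ((Real.exp (2 * Real.pi * x) : ℝ) : ℂ) ^ (-1/2 + Complex.I * η) =
        ((Real.exp (-(Real.pi * x)) : ℝ) : ℂ) * Complex.exp (2 * Real.pi * x * Complex.I * η) := by
      rw [exp_cpow_aux, Complex.ofReal_exp, ← Complex.exp_add]
      congr 1; push_cast; ring
    have e3 : 2 * Real.pi * Real.exp (2 * Real.pi * x) * Real.exp (-(Real.pi * x)) * (1 / (1 + Real.exp (2 * Real.pi * x)))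
        = 2 * Real.pi * gfun 1 x := by
      rw [one_add_exp_aux, show 2 * Real.pi * x = Real.pi * x + Real.pi * x by ring, Real.exp_add, Real.exp_neg]
      unfold gfun
      field_simp
    rw [e2]
    calc _ = ((2 * Real.pi * Real.exp (2 * Real.pi * x) * Real.exp (-(Real.pi * x)) * (1 / (1 + Real.exp (2 * Real.pi * x))) : ℝ) : ℂ)
          * Complex.exp (2 * Real.pi * x * Complex.I * η) := by push_cast; ring
      _ = _ := by rw [e3, ← e1]; push_cast; ring
  simp_rw [key] at h
  rw [integral_const_mul] at h
  have hp : (Real.pi : ℂ) ≠ 0 := by exact_mod_cast Real.pi_pos.ne'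
  have hs : (a : ℂ) ^ (1/2 : ℂ) = ((Real.sqrt a : ℝ) : ℂ) := by
    rw [Real.sqrt_eq_rpow, Complex.ofReal_cpow ha.le]; norm_num
  have hsa : 0 < Real.sqrt a := Real.sqrt_pos.2 ha
  have hC : Real.cosh (Real.pi * η) = (a + 1) / (2 * Real.sqrt a) := by
    rw [hla, ← Real.log_sqrt ha.le, Real.cosh_log hsa]
    have := Real.mul_self_sqrt ha.le
    field_simp
    nlinarith
  rw [hs, hC] at h
  simp only [Complex.ofReal_one, Complex.one_cpow, one_mul] at h
  have hs0 : ((Real.sqrt a : ℝ) : ℂ) ≠ 0 := by exact_mod_cast hsa.ne'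
  have : 2 * (Real.pi : ℂ) * (Real.sqrt a : ℂ) ≠ 0 := mul_ne_zero (mul_ne_zero two_ne_zero hp) hs0
  apply mul_left_cancel₀ this
  rw [h]
  norm_cast
  field_simp

noncomputable def Fch : ℕ → ℝ → ENNReal
  | 0, a => ENNReal.ofReal (1 / (a + 1))
  | m + 1, a => ∫⁻ v in Set.Ioi (0:ℝ), ENNReal.ofReal (1 / (a + v)) * Fch m v

lemma gfun_measurable (N : ℕ) : Measurable (gfun N) := by
  unfold gfun
  fun_prop

lemma norm_half_cpow (v x : ℝ) (hv : 0 < v) : ‖(v : ℂ) ^ (-1/2 + Complex.I * x)‖ = v ^ (-1/2 : ℝ) := by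
  rw [Complex.norm_cpow_eq_rpow_re_of_pos hv]
  congr 1
  simp

lemma ker_integrable (a : ℝ) (ha : 0 < a) (N : ℕ) (hN : 1 ≤ N) :
    Integrable (Function.uncurry (fun v x : ℝ =>
      ((v : ℂ) ^ (-1/2 + Complex.I * x) * (1 / ((a + v : ℝ) : ℂ))) * (gfun N x : ℂ)))
      ((volume.restrict (Set.Ioi 0)).prod volume) := by
  have h1 := (mellinA a ha 0).1.norm
  have h2 := (gfun_integral N hN).1
  have h3 := Integrable.mul_prod h1 h2
  have hg := gfun_measurable N
  refine h3.mono' ?_ ?_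
  · apply Measurable.aestronglyMeasurable
    unfold Function.uncurry
    fun_prop
  · have : ∀ᵐ z ∂((volume.restrict (Set.Ioi (0:ℝ))).prod (volume : Measure ℝ)), 0 < z.1 := by
      have h0 : ∀ᵐ z ∂(volume.restrict (Set.Ioi (0:ℝ))), 0 < z := ae_restrict_mem measurableSet_Ioi
      exact Measure.quasiMeasurePreserving_fst.ae h0
    filter_upwards [this] with z hz
    simp only [Function.uncurry]
    rw [norm_mul, norm_mul, norm_mul, norm_half_cpow _ _ hz, norm_half_cpow _ _ hz, Complex.norm_real (gfun N z.2),
      Real.norm_of_nonneg (gfun_nonneg N z.2)]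

lemma chain (m : ℕ) : ∃ f : ℝ → ℝ, ∀ a : ℝ, 0 < a → 0 ≤ f a ∧ Fch m a = ENNReal.ofReal (f a) ∧
    (f a : ℂ) = ∫ x : ℝ, (a : ℂ) ^ (-1/2 + Complex.I * x) * (gfun (m + 1) x : ℂ) := by
  induction m with
  | zero => exact ⟨fun a => 1 / (a + 1), fun a ha => ⟨by positivity, rfl, mellinB a ha⟩⟩
  | succ m ih =>
    obtain ⟨f, hf⟩ := ih
    refine ⟨fun a => ∫ v in Set.Ioi (0:ℝ), 1 / (a + v) * f v, fun a ha => ?_⟩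
    have hI := ker_integrable a ha (m + 1) (by omega)
    have h1 : (fun v : ℝ => ∫ x : ℝ, ((v : ℂ) ^ (-1/2 + Complex.I * x) * (1 / ((a + v : ℝ) : ℂ))) * (gfun (m + 1) x : ℂ))
        =ᵐ[volume.restrict (Set.Ioi 0)] fun v : ℝ => ((1 / (a + v) * f v : ℝ) : ℂ) := by
      filter_upwards [ae_restrict_mem measurableSet_Ioi] with v hv
      push_cast
      rw [(hf v hv).2.2, ← integral_const_mul]
      congr 1; ext x; push_cast; ring
    have hint : Integrable (fun v : ℝ => 1 / (a + v) * f v) (volume.restrict (Set.Ioi 0)) := by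
      have h2 := (hI.integral_prod_left.congr h1).re
      simpa only [RCLike.re_to_complex, Complex.ofReal_re] using h2
    have hnn : ∀ᵐ v ∂(volume.restrict (Set.Ioi (0:ℝ))), 0 ≤ 1 / (a + v) * f v := by
      filter_upwards [ae_restrict_mem measurableSet_Ioi] with v hv
      have hv' : (0:ℝ) < v := hv
      have := (hf v hv).1
      positivity
    refine ⟨integral_nonneg_of_ae hnn, ?_, ?_⟩
    · rw [ofReal_integral_eq_lintegral_ofReal hint hnn, Fch]
      refine setLIntegral_congr_fun measurableSet_Ioi fun v hv => ?_
      have hv' : (0:ℝ) < v := hv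
      try simp only
      rw [(hf v hv).2.1, ENNReal.ofReal_mul (by positivity)]
    · have h3 := integral_integral_swap hI
      rw [integral_congr_ae h1, integral_complex_ofReal] at h3
      rw [h3]
      congr 1; ext x
      rw [integral_mul_const, (mellinA a ha x).2, gfun_succ (m + 1)]
      push_cast; ring

lemma Fch_one (m : ℕ) : Fch m 1 = ENNReal.ofReal ((2 * Real.pi) ^ (m + 1) / (2 * Real.pi) ^ 2 *
    (Real.Gamma (((m + 1 : ℕ) : ℝ) / 2) ^ 2 / Real.Gamma ((m + 1 : ℕ) : ℝ))) := by
  obtain ⟨f, hf⟩ := chain m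
  obtain ⟨_, h2, h3⟩ := hf 1 one_pos
  rw [h2, ← (gfun_integral (m + 1) (by omega)).2]
  congr 1
  simp only [Complex.ofReal_one, Complex.one_cpow, one_mul] at h3
  rw [integral_complex_ofReal] at h3
  exact_mod_cast h3

abbrev orth (n : ℕ) : Set (Fin n → ℝ) := Set.univ.pi fun _ : Fin n => Set.Ioi (0 : ℝ)

lemma orth_meas (n : ℕ) : MeasurableSet (orth n) :=
  MeasurableSet.univ_pi fun _ => measurableSet_Ioi

lemma split_lint (m : ℕ) (H : (Fin (m + 1) → ℝ) → ENNReal) (hH : Measurable H) :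
    ∫⁻ u in orth (m + 1), H u = ∫⁻ x in Set.Ioi (0:ℝ), ∫⁻ w in orth m, H (Fin.cons x w) := by
  have hp := (volume_preserving_piFinSuccAbove (fun _ : Fin (m + 1) => ℝ) 0).symm
  rw [← hp.setLIntegral_comp_preimage_emb (MeasurableEquiv.measurableEmbedding _)]
  have hset : (MeasurableEquiv.piFinSuccAbove (fun _ : Fin (m + 1) => ℝ) 0).symm ⁻¹' (orth (m + 1)) =
      Set.Ioi (0:ℝ) ×ˢ orth m := by
    ext ⟨x, w⟩
    simp [orth, Set.mem_pi, Fin.forall_fin_succ, MeasurableEquiv.piFinSuccAbove]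
  rw [hset, Measure.volume_eq_prod, ← Measure.prod_restrict, lintegral_prod]
  · simp [MeasurableEquiv.piFinSuccAbove, Fin.insertNthEquiv]
  · exact (hH.comp (MeasurableEquiv.measurable _)).aemeasurable

lemma scale_lint (m : ℕ) (c : ℝ) (hc : 0 < c) (H : (Fin m → ℝ) → ENNReal) (hH : Measurable H) :
    ∫⁻ w in orth m, H w = ENNReal.ofReal (c ^ m) * ∫⁻ v in orth m, H (c • v) := by
  have hmeas : Measurable fun x : Fin m → ℝ => c • x := by fun_prop
  have h := Measure.map_addHaar_smul (volume : Measure (Fin m → ℝ)) hc.ne'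
  have hset : (fun x : Fin m → ℝ => c • x) ⁻¹' (orth m) = orth m := by
    ext x; simp [orth, Set.mem_pi, hc]
  have h2 : ∫⁻ v in orth m, H (c • v) = ∫⁻ w in orth m, H w ∂(Measure.map (fun x => c • x) volume) := by
    rw [setLIntegral_map (orth_meas m) hH hmeas, hset]
  rw [h2, h, Measure.restrict_smul, lintegral_smul_measure, smul_eq_mul, ← mul_assoc, ← ENNReal.ofReal_mul (by positivity)]
  have : c ^ m * |(c ^ Module.finrank ℝ (Fin m → ℝ))⁻¹| = 1 := by
    rw [Module.finrank_fin_fun, abs_of_pos (by positivity), mul_inv_cancel₀ (by positivity)]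
  rw [this]; simp

def Qch : (m : ℕ) → ℝ → (Fin m → ℝ) → ℝ
  | 0, a, _ => a + 1
  | m + 1, a, v => (a + v 0) * Qch m (v 0) (fun i => v i.succ)

lemma Qch_eq (m : ℕ) : ∀ (a : ℝ) (v : Fin m → ℝ),
    Qch m a v = ∏ j : Fin (m + 1), ((Fin.cons a v : Fin (m + 1) → ℝ) j + (Fin.snoc v 1 : Fin (m + 1) → ℝ) j) := by
  induction m with
  | zero => intro a v; simp [Qch, Fin.snoc]
  | succ m ih =>
    intro a v
    rw [Qch, Fin.prod_univ_succ, ih]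
    congr 1
    · refine Finset.prod_congr rfl fun j _ => ?_
      congr 1
      · rw [Fin.cons_succ]
        refine Fin.cases ?_ (fun i => ?_) j <;> simp
      · refine Fin.lastCases ?_ (fun i => ?_) j
        · rw [Fin.succ_last, Fin.snoc_last, Fin.snoc_last]
        · rw [Fin.succ_castSucc, Fin.snoc_castSucc, Fin.snoc_castSucc]

lemma Qch_cyc (m : ℕ) (v : Fin m → ℝ) :
    ∏ j : Fin (m + 1), ((Fin.cons 1 v : Fin (m + 1) → ℝ) j + (Fin.cons 1 v : Fin (m + 1) → ℝ) (j + 1)) = Qch m 1 v := by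
  rw [Qch_eq]
  refine Finset.prod_congr rfl fun j _ => ?_
  congr 1
  refine Fin.lastCases ?_ (fun i => ?_) j
  · simp
  · rw [Fin.snoc_castSucc, Fin.coeSucc_eq_succ, Fin.cons_succ]

lemma Qch_pos (m : ℕ) : ∀ (a : ℝ) (v : Fin m → ℝ), 0 < a → v ∈ orth m → 0 < Qch m a v := by
  induction m with
  | zero => intro a v ha _; rw [Qch]; linarith
  | succ m ih =>
    intro a v ha hv
    have hv' : ∀ i, 0 < v i := fun i => hv i (Set.mem_univ i)
    rw [Qch]
    exact mul_pos (add_pos ha (hv' 0)) (ih _ _ (hv' 0) (fun i _ => hv' i.succ))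

lemma Qch_meas (m : ℕ) : Measurable (fun p : ℝ × (Fin m → ℝ) => Qch m p.1 p.2) := by
  induction m with
  | zero => unfold Qch; fun_prop
  | succ m ih =>
    have : Measurable (fun p : ℝ × (Fin (m + 1) → ℝ) => ((p.2 0, fun i => p.2 (Fin.succ i)) : ℝ × (Fin m → ℝ))) := by
      fun_prop
    have h := ih.comp this
    have h2 : Measurable (fun p : ℝ × (Fin (m + 1) → ℝ) => p.1 + p.2 0) := by fun_prop
    exact h2.mul h

lemma lint_Q (m : ℕ) : ∀ a : ℝ, 0 < a → ∫⁻ v in orth m, ENNReal.ofReal (1 / Qch m a v) = Fch m a := by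
  induction m with
  | zero =>
    intro a ha
    have : orth 0 = Set.univ := by ext x; simp [orth]
    simp only [Qch, Fch, lintegral_const, this, Measure.restrict_univ]
    simp [volume_pi]
  | succ m ih =>
    intro a ha
    have hm : Measurable (fun v => Qch (m + 1) a v) := (Qch_meas (m + 1)).comp (measurable_const.prodMk measurable_id)
    rw [split_lint _ _ (by fun_prop), Fch]
    refine setLIntegral_congr_fun measurableSet_Ioi fun x hx => ?_
    have hx' : (0:ℝ) < x := hx
    have hm2 : Measurable (fun v => Qch m x v) := (Qch_meas m).comp (measurable_const.prodMk measurable_id)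
    try simp only
    rw [← ih x hx, ← lintegral_const_mul _ (by fun_prop)]
    refine setLIntegral_congr_fun (orth_meas m) fun v hv => ?_
    try simp only
    rw [← ENNReal.ofReal_mul (by positivity), Qch]
    simp only [Fin.cons_zero, Fin.cons_succ]
    rw [one_div_mul_one_div]

lemma cyc_meas (n : ℕ) [NeZero n] : Measurable (cyclicIntegrand n) := by
  unfold cyclicIntegrand
  fun_prop

lemma lint_exp (S c : ℝ) (hS : 0 < S) (hc : 0 < c) :
    ∫⁻ x in Set.Ioi (0:ℝ), ENNReal.ofReal (S * Real.exp (-(S * x)) / c) = ENNReal.ofReal (1 / c) := by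
  have h1 := aux_int 1 S one_pos hS
  have h2 := Real.integral_rpow_mul_exp_neg_mul_Ioi one_pos hS
  simp only [sub_self, Real.rpow_zero, one_mul, Real.rpow_one, Real.Gamma_one, mul_one] at h1 h2
  rw [← ofReal_integral_eq_lintegral_ofReal]
  · rw [integral_div, integral_const_mul, h2, mul_one_div_cancel hS.ne']
  · exact (h1.const_mul S).div_const c
  · exact Filter.Eventually.of_forall fun x => by simp only [Pi.zero_apply]; positivity

lemma lint_main (m : ℕ) : ∫⁻ u in orth (m + 1), ENNReal.ofReal (cyclicIntegrand (m + 1) u) = Fch m 1 := by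
  have hcm := cyc_meas (m + 1)
  have hcons : Measurable (fun p : ℝ × (Fin m → ℝ) => (Fin.cons p.1 p.2 : Fin (m + 1) → ℝ)) := by
    refine measurable_pi_lambda _ fun i => ?_
    refine Fin.cases ?_ (fun i => ?_) i
    · simp only [Fin.cons_zero]; fun_prop
    · simp only [Fin.cons_succ]; fun_prop
  rw [split_lint _ _ (by fun_prop), ← lint_Q m 1 one_pos]
  have hA : ∀ x : ℝ, 0 < x → ∫⁻ w in orth m, ENNReal.ofReal (cyclicIntegrand (m + 1) (Fin.cons x w)) =
      ∫⁻ v in orth m, ENNReal.ofReal (x ^ m * cyclicIntegrand (m + 1) (Fin.cons x (x • v))) := by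
    intro x hx
    have h1 : Measurable (fun w : Fin m → ℝ => (Fin.cons x w : Fin (m + 1) → ℝ)) :=
      hcons.comp (measurable_const.prodMk measurable_id)
    rw [scale_lint m x hx _ (by fun_prop), ← lintegral_const_mul _ (by fun_prop)]
    congr 1; ext v
    rw [ENNReal.ofReal_mul (by positivity)]
  rw [setLIntegral_congr_fun measurableSet_Ioi (fun x hx => hA x hx), lintegral_lintegral_swap]
  · refine setLIntegral_congr_fun (orth_meas m) fun v hv => ?_
    have hv' : ∀ i, 0 < v i := fun i => hv i (Set.mem_univ i)
    have hQ := Qch_pos m 1 v one_pos hv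
    have hS : 0 < 1 + ∑ i, v i := add_pos_of_pos_of_nonneg one_pos (Finset.sum_nonneg fun i _ => (hv' i).le)
    try simp only
    rw [← lint_exp (1 + ∑ i, v i) _ hS hQ]
    refine setLIntegral_congr_fun measurableSet_Ioi fun x hx => ?_
    have hx' : (0:ℝ) < x := hx
    try simp only
    congr 1
    have e : (Fin.cons x (x • v) : Fin (m + 1) → ℝ) = fun j => x * (Fin.cons 1 v : Fin (m + 1) → ℝ) j := by
      ext j
      refine Fin.cases ?_ (fun i => ?_) j <;> simp
    rw [e]
    unfold cyclicIntegrand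
    simp only [← mul_add, ← Finset.mul_sum]
    rw [Finset.prod_mul_distrib, Qch_cyc, Fin.sum_univ_succ]
    simp only [Fin.cons_zero, Fin.cons_succ, Finset.prod_const, Finset.card_univ, Fintype.card_fin]
    rw [mul_comm (1 + ∑ i, v i) x]
    field_simp
    ring
  · have h2 : Measurable (fun p : ℝ × (Fin m → ℝ) => (p.1, p.1 • p.2)) := by fun_prop
    have h3 := hcons.comp h2
    have h4 : Measurable (fun p : ℝ × (Fin m → ℝ) => (Fin.cons p.1 (p.1 • p.2) : Fin (m + 1) → ℝ)) := h3
    apply Measurable.aemeasurable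
    unfold Function.uncurry
    fun_prop

lemma main_part (n : ℕ) [NeZero n] (hn : 2 ≤ n) :
      IntegrableOn (cyclicIntegrand n) (Set.univ.pi fun _ : Fin n => Set.Ioi (0 : ℝ)) ∧
      (∫ u in Set.univ.pi fun _ : Fin n => Set.Ioi (0 : ℝ), cyclicIntegrand n u) =
        (2 * Real.pi) ^ (n - 2) * Real.Gamma ((n : ℝ) / 2) ^ 2 / Real.Gamma (n : ℝ) := by
  obtain ⟨m, rfl⟩ : ∃ m, n = m + 1 := ⟨n - 1, by omega⟩
  have h := lint_main m
  rw [Fch_one] at h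
  have hmeas := cyc_meas (m + 1)
  have hnn : ∀ᵐ u ∂(volume.restrict (orth (m + 1))), 0 ≤ cyclicIntegrand (m + 1) u := by
    filter_upwards [ae_restrict_mem (orth_meas (m + 1))] with u hu
    have hu' : ∀ i, 0 < u i := fun i => hu i (Set.mem_univ i)
    unfold cyclicIntegrand
    refine div_nonneg (mul_nonneg (Finset.sum_nonneg fun i _ => (hu' i).le) (Real.exp_pos _).le)
      (Finset.prod_nonneg fun i _ => (add_pos (hu' _) (hu' _)).le)
  constructor
  · refine ⟨hmeas.aestronglyMeasurable, ?_⟩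
    rw [hasFiniteIntegral_iff_ofReal hnn, h]
    exact ENNReal.ofReal_lt_top
  · rw [integral_eq_lintegral_of_nonneg_ae hnn hmeas.aestronglyMeasurable, h, ENNReal.toReal_ofReal]
    · obtain ⟨k, hk⟩ : ∃ k, m + 1 = k + 2 := ⟨m - 1, by omega⟩
      rw [hk, Nat.add_sub_cancel, pow_add]
      have := Real.pi_pos.ne'
      field_simp
    · have : 0 < Real.Gamma ((m + 1 : ℕ) : ℝ) := Real.Gamma_pos_of_pos (by positivity)
      positivity

/-- For every `n ≥ 2` the integral
`I_n = ∫_{(0,∞)ⁿ} du |u|₁ e^{−|u|₁} / ∏_{j=1}^n (u_j + u_{j+1})` (cyclic convention) is finite and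
equals `(2π)^{n−2} Γ(n/2)² / Γ(n)`; in particular, for every `n ≥ 1`,
`I_{2n} = (2π)^{2n−2} ((n−1)!)² / (2n−1)!`. -/
theorem statement6 :
    (∀ (n : ℕ) [NeZero n], 2 ≤ n →
      IntegrableOn (cyclicIntegrand n) (Set.univ.pi fun _ : Fin n => Set.Ioi (0 : ℝ)) ∧
      (∫ u in Set.univ.pi fun _ : Fin n => Set.Ioi (0 : ℝ), cyclicIntegrand n u) =
        (2 * Real.pi) ^ (n - 2) * Real.Gamma ((n : ℝ) / 2) ^ 2 / Real.Gamma (n : ℝ)) ∧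
    (∀ n : ℕ, 1 ≤ n →
      ∀ (_ : NeZero (2 * n)),
      (∫ u in Set.univ.pi fun _ : Fin (2 * n) => Set.Ioi (0 : ℝ), cyclicIntegrand (2 * n) u) =
        (2 * Real.pi) ^ (2 * n - 2) * ((n - 1).factorial : ℝ) ^ 2 / ((2 * n - 1).factorial : ℝ)) := by
  refine ⟨fun n _ hn => main_part n hn, fun n hn _ => ?_⟩
  rw [(main_part (2 * n) (by omega)).2]
  obtain ⟨k, rfl⟩ : ∃ k, n = k + 1 := ⟨n - 1, by omega⟩
  have e1 : ((2 * (k + 1) : ℕ) : ℝ) / 2 = (k : ℝ) + 1 := by push_cast; ring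
  have e2 : ((2 * (k + 1) : ℕ) : ℝ) = ((2 * k + 1 : ℕ) : ℝ) + 1 := by push_cast; ring
  rw [e1, Real.Gamma_nat_eq_factorial, e2, Real.Gamma_nat_eq_factorial]
  rfl
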